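/- For every complex d × d matrix θ, the sum over all i ∈ ZMod d × ZMod d of D(i) · θ · D(i)† equals d · (Tr θ) times the identity matrix. -/

import Mathlib

open scoped Matrix

noncomputable section

/-- `ω(r) = exp(2πi r / d)` for `r ∈ ZMod d`. -/
def omg (d : ℕ) (r : ZMod d) : ℂ := Complex.exp (2 * Real.pi * Complex.I * r.val / d)

/-- The matrix `Z` with `Z|m⟩ = ω(m)|m⟩`. -/
def Zmat (d : ℕ) [Fact d.Prime] : Matrix (ZMod d) (ZMod d) ℂ :=
  Matrix.diagonal fun m => omg d m

/-- The matrix `X` with `X|m⟩ = |m+1⟩`. -/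
def Xmat (d : ℕ) [Fact d.Prime] : Matrix (ZMod d) (ZMod d) ℂ :=
  Matrix.of fun m n => if m = n + 1 then 1 else 0

/-- The displacement operator `D(α,β) = ω(-2⁻¹αβ) Z^α X^β`. -/
def Dmat (d : ℕ) [Fact d.Prime] (i : ZMod d × ZMod d) : Matrix (ZMod d) (ZMod d) ℂ :=
  omg d (-(2⁻¹ * i.1 * i.2)) • (Zmat d ^ (i.1).val * Xmat d ^ (i.2).val)

lemma omg_eq (d : ℕ) [Fact d.Prime] (r : ZMod d) : omg d r = ZMod.stdAddChar r := by
  rw [ZMod.stdAddChar_apply, ZMod.toCircle_apply, omg]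

lemma Xmat_pow (d : ℕ) [Fact d.Prime] (k : ℕ) (m n : ZMod d) :
    (Xmat d ^ k) m n = if n = m - k then 1 else 0 := by
  induction k generalizing m n with
  | zero => simp [Matrix.one_apply, eq_comm]
  | succ k ih =>
    rw [pow_succ, Matrix.mul_apply]
    simp only [ih]
    simp only [Xmat, Matrix.of_apply, ite_mul, one_mul, zero_mul, Finset.sum_ite_eq',
      Finset.sum_ite_eq, Finset.mem_univ, if_true]
    congr 1
    push_cast
    apply propext
    constructor
    · intro h; linear_combination -h
    · intro h; linear_combination -h

lemma Dmat_apply (d : ℕ) [Fact d.Prime] (a b m n : ZMod d) :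
    Dmat d (a, b) m n = ZMod.stdAddChar (-(2⁻¹ * a * b)) *
      (ZMod.stdAddChar (a * m) * if n = m - b then 1 else 0) := by
  have h : (ZMod.stdAddChar m : ℂ) ^ a.val = ZMod.stdAddChar (a * m) := by
    rw [← AddChar.map_nsmul_eq_pow, nsmul_eq_mul, ZMod.natCast_zmod_val]
  simp only [Dmat, Zmat, Matrix.smul_apply, smul_eq_mul, Matrix.diagonal_pow,
    Matrix.diagonal_mul, Xmat_pow, Pi.pow_apply, omg_eq, h, ZMod.natCast_zmod_val]

lemma conj_apply (d : ℕ) [Fact d.Prime] (θ : Matrix (ZMod d) (ZMod d) ℂ) (a b m n : ZMod d) :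
    (Dmat d (a, b) * θ * (Dmat d (a, b))ᴴ) m n
      = ZMod.stdAddChar (a * (m - n)) * θ (m - b) (n - b) := by
  have hc (x : ZMod d) : star (ZMod.stdAddChar x : ℂ) = ZMod.stdAddChar (-x) :=
    (AddChar.map_neg_eq_conj _ _).symm
  simp only [Matrix.mul_apply, Matrix.conjTranspose_apply, Dmat_apply, star_mul', hc, apply_ite star,
    star_one, star_zero, mul_ite, ite_mul, mul_one, mul_zero, zero_mul, Finset.sum_ite_eq',
    Finset.sum_ite_eq, Finset.mem_univ, if_true]
  have e : (ZMod.stdAddChar (a * (m - n)) : ℂ) = ZMod.stdAddChar (-(2⁻¹ * a * b)) *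
      ZMod.stdAddChar (a * m) * (ZMod.stdAddChar (- -(2⁻¹ * a * b)) *
        ZMod.stdAddChar (-(a * n))) := by
    simp only [← AddChar.map_add_eq_mul]
    congr 1
    ring
  rw [e]
  ring

/-- For every complex `d × d` matrix `θ`, the sum over all
`i ∈ ZMod d × ZMod d` of `D(i) θ D(i)†` equals `d · (Tr θ)` times the identity matrix. -/
theorem sum_displacement_conj_eq_trace_smul_one
    (d : ℕ) [Fact d.Prime] (hodd : Odd d) (θ : Matrix (ZMod d) (ZMod d) ℂ) :
    ∑ i : ZMod d × ZMod d, Dmat d i * θ * (Dmat d i)ᴴ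
      = ((d : ℂ) * θ.trace) • (1 : Matrix (ZMod d) (ZMod d) ℂ) := by
  ext m n
  rw [Matrix.sum_apply, Fintype.sum_prod_type]
  simp only [conj_apply, ← Finset.mul_sum]
  rw [← Finset.sum_mul]
  rw [AddChar.sum_mulShift (m - n) (ZMod.isPrimitive_stdAddChar d)]
  by_cases h : m = n
  · subst h
    have ht : ∑ b, θ (m - b) (m - b) = θ.trace := by
      rw [Matrix.trace]
      exact Equiv.sum_comp (Equiv.subLeft m) (fun k => θ k k)
    simp [ht, ZMod.card]
  · simp [h, sub_eq_zero]

end
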